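/- Let ν ≥ 1, p ∈ [1,2], and a ∈ ℝ^ν with a_i ≥ 0 for all i. Then the infimum over vectors υ ∈ ℝ^ν with all υ_i > 0 of the quantity ¼·∑_{i=1}^ν a_i²/υ_i + ‖υ‖_{p/(2−p)} equals ‖a‖_p; here, for p = 2, ‖·‖_{p/(2−p)} is interpreted as the sup-norm ‖·‖_∞. -/

import Mathlib

open BigOperators

/-- The Hölder bound `‖a‖_p ≤ (∑ aᵢ²/υᵢ)^{1/2} ‖υ‖_{p/(2-p)}^{1/2}` for `p < 2`, raised to the
power `p`. -/
lemma sum_rpow_le_of_lt_two {ι : Type*} [Fintype ι] {p : ℝ} (hp1 : 1 ≤ p) (hp2 : p < 2)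
    {a υ : ι → ℝ} (ha : ∀ i, 0 ≤ a i) (hυ : ∀ i, 0 < υ i) :
    ∑ i, a i ^ p ≤ (∑ i, a i ^ 2 / υ i) ^ (p / 2) *
      (∑ i, |υ i| ^ (p / (2 - p))) ^ ((2 - p) / 2) := by
  have h2p : 0 < 2 - p := by linarith
  have hp0 : 0 < p := by linarith
  have hc : (2 / p).HolderConjugate (2 / (2 - p)) := by
    rw [Real.holderConjugate_iff]
    refine ⟨by rw [lt_div_iff₀ hp0]; linarith, ?_⟩
    field_simp
    ring
  have h := Real.inner_le_Lp_mul_Lq_of_nonneg Finset.univ hc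
    (f := fun i => (a i ^ 2 / υ i) ^ (p / 2)) (g := fun i => υ i ^ (p / 2))
    (fun i _ => Real.rpow_nonneg (div_nonneg (sq_nonneg _) (hυ i).le) _)
    (fun i _ => Real.rpow_nonneg (hυ i).le _)
  refine Eq.trans_le ?_ (h.trans_eq (congrArg₂ _ ?_ ?_))
  · refine Finset.sum_congr rfl fun i _ => ?_
    rw [← Real.mul_rpow (div_nonneg (sq_nonneg _) (hυ i).le) (hυ i).le,
      div_mul_cancel₀ _ (hυ i).ne', ← Real.rpow_natCast, ← Real.rpow_mul (ha i)]
    congr 1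
    push_cast
    ring
  · rw [one_div_div]
    congr 1
    refine Finset.sum_congr rfl fun i _ => ?_
    rw [← Real.rpow_mul (div_nonneg (sq_nonneg _) (hυ i).le), div_mul_div_cancel₀ two_ne_zero,
      div_self hp0.ne', Real.rpow_one]
  · rw [one_div_div]
    congr 1
    refine Finset.sum_congr rfl fun i _ => ?_
    rw [abs_of_pos (hυ i), ← Real.rpow_mul (hυ i).le, div_mul_div_cancel₀ two_ne_zero]

/-- If `‖a‖ ≤ √(S N)` then `‖a‖ ≤ S / 4 + N`, written for `‖a‖ = T^{1/p}`. -/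
lemma rpow_one_div_le_quarter_add {p T S N : ℝ} (hp : 0 < p) (hT : 0 ≤ T) (hS : 0 ≤ S)
    (hN : 0 ≤ N) (h : T ≤ (S * N) ^ (p / 2)) : T ^ (1 / p) ≤ 1 / 4 * S + N := by
  have h1 : T ^ (1 / p) ≤ (S * N) ^ (1 / 2 : ℝ) := by
    refine (Real.rpow_le_rpow hT h (by positivity)).trans_eq ?_
    rw [← Real.rpow_mul (by positivity)]
    congr 1
    field_simp
  rw [← Real.sqrt_eq_rpow] at h1
  refine h1.trans (Real.sqrt_le_iff.2 ⟨by positivity, ?_⟩)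
  nlinarith [sq_nonneg (1 / 4 * S - N)]

/-- The objective function bounds `‖a‖_p` from above. -/
lemma norm_le_quarter_sum_add_norm {ι : Type*} [Fintype ι] {p : ℝ} (hp1 : 1 ≤ p)
    (hp2 : p ≤ 2) {a υ : ι → ℝ} (ha : ∀ i, 0 ≤ a i) (hυ : ∀ i, 0 < υ i) :
    (∑ i, a i ^ p) ^ (1 / p) ≤ (1 / 4 : ℝ) * (∑ i, a i ^ 2 / υ i) +
      (if p = 2 then ⨆ i, |υ i|
        else (∑ i, |υ i| ^ (p / (2 - p))) ^ ((2 - p) / p)) := by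
  have hp0 : 0 < p := by linarith
  have hS : 0 ≤ ∑ i, a i ^ 2 / υ i :=
    Finset.sum_nonneg fun i _ => div_nonneg (sq_nonneg _) (hυ i).le
  have hT : 0 ≤ ∑ i, a i ^ p := Finset.sum_nonneg fun i _ => Real.rpow_nonneg (ha i) _
  split_ifs with h
  · refine rpow_one_div_le_quarter_add hp0 hT hS (Real.iSup_nonneg fun i => abs_nonneg _) ?_
    subst h
    rw [div_self two_ne_zero, Real.rpow_one, Finset.sum_mul]
    refine Finset.sum_le_sum fun i _ => ?_
    have hle : υ i ≤ ⨆ j, |υ j| :=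
      (le_abs_self _).trans (le_ciSup (f := fun j => |υ j|) (Set.finite_range _).bddAbove i)
    calc a i ^ (2 : ℝ) = a i ^ 2 / υ i * υ i := by
          rw [div_mul_cancel₀ _ (hυ i).ne', Real.rpow_two]
      _ ≤ _ := mul_le_mul_of_nonneg_left hle (div_nonneg (sq_nonneg _) (hυ i).le)
  · have hV : 0 ≤ ∑ i, |υ i| ^ (p / (2 - p)) :=
      Finset.sum_nonneg fun i _ => Real.rpow_nonneg (abs_nonneg _) _
    refine rpow_one_div_le_quarter_add hp0 hT hS (Real.rpow_nonneg hV _) ?_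
    rw [Real.mul_rpow hS (Real.rpow_nonneg hV _), ← Real.rpow_mul hV,
      div_mul_div_cancel₀ hp0.ne']
    exact sum_rpow_le_of_lt_two hp1 (lt_of_le_of_ne hp2 h) ha hυ

/-- For positive `b`, the objective function attains the value `‖b‖_p`. -/
lemma exists_quarter_sum_add_norm_eq {ι : Type*} [Fintype ι] [Nonempty ι] {p : ℝ}
    (hp1 : 1 ≤ p) {b : ι → ℝ} (hb : ∀ i, 0 < b i) :
    ∃ υ : ι → ℝ, (∀ i, 0 < υ i) ∧
      (1 / 4 : ℝ) * (∑ i, b i ^ 2 / υ i) +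
        (if p = 2 then ⨆ i, |υ i|
          else (∑ i, |υ i| ^ (p / (2 - p))) ^ ((2 - p) / p)) = (∑ i, b i ^ p) ^ (1 / p) := by
  have hp0 : 0 < p := by linarith
  set T := ∑ i, b i ^ p with hTdef
  have hT : 0 < T := Finset.sum_pos (fun i _ => Real.rpow_pos_of_pos (hb i) _)
    Finset.univ_nonempty
  set c : ℝ := 1 / 2 * T ^ ((p - 1) / p) with hc
  have hc0 : 0 < c := by positivity
  have hυ : ∀ i, 0 < c * b i ^ (2 - p) := fun i => mul_pos hc0 (Real.rpow_pos_of_pos (hb i) _)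
  have hcT : T / c = 2 * T ^ (1 / p) := by
    rw [div_eq_iff hc0.ne', hc]
    have : T ^ (1 / p) * T ^ ((p - 1) / p) = T := by
      rw [← Real.rpow_add hT, ← add_div, add_sub_cancel, div_self hp0.ne', Real.rpow_one]
    linear_combination -this
  have hS : ∑ i, b i ^ 2 / (c * b i ^ (2 - p)) = 2 * T ^ (1 / p) := by
    rw [← hcT, hTdef, Finset.sum_div]
    refine Finset.sum_congr rfl fun i _ => ?_
    rw [mul_comm, ← div_div, ← Real.rpow_two, ← Real.rpow_sub (hb i), sub_sub_cancel]
  refine ⟨fun i => c * b i ^ (2 - p), hυ, ?_⟩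
  have hN : (if p = 2 then ⨆ i, |c * b i ^ (2 - p)|
      else (∑ i, |c * b i ^ (2 - p)| ^ (p / (2 - p))) ^ ((2 - p) / p))
      = 1 / 2 * T ^ (1 / p) := by
    split_ifs with h
    · have hconst : ∀ i, |c * b i ^ (2 - p)| = c := fun i => by
        rw [abs_of_pos (hυ i), h, sub_self, Real.rpow_zero, mul_one]
      simp_rw [hconst, ciSup_const, hc]
      norm_num [h]
    · have h2p : 2 - p ≠ 0 := sub_ne_zero.2 (Ne.symm h)
      have hsum : ∑ i, |c * b i ^ (2 - p)| ^ (p / (2 - p)) = c ^ (p / (2 - p)) * T := by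
        rw [hTdef, Finset.mul_sum]
        refine Finset.sum_congr rfl fun i _ => ?_
        rw [abs_of_pos (hυ i), Real.mul_rpow hc0.le (Real.rpow_nonneg (hb i).le _),
          ← Real.rpow_mul (hb i).le, mul_div_cancel₀ _ h2p]
      rw [hsum, Real.mul_rpow (Real.rpow_nonneg hc0.le _) hT.le, ← Real.rpow_mul hc0.le,
        div_mul_div_cancel₀ h2p, div_self hp0.ne', Real.rpow_one, hc, mul_assoc,
        ← Real.rpow_add hT]
      congr 2
      ring
  rw [hS, hN]
  ring

/-- for `1 ≤ p ≤ 2` and `a ≥ 0`,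
`inf_{υ > 0} ¼ ∑ aᵢ²/υᵢ + ‖υ‖_{p/(2-p)} = ‖a‖_p`
(with `‖·‖_{p/(2-p)}` read as the sup-norm when `p = 2`). -/
theorem inf_quarter_sum_add_norm
    (ν : ℕ) (hν : 1 ≤ ν) (p : ℝ) (hp1 : 1 ≤ p) (hp2 : p ≤ 2)
    (a : Fin ν → ℝ) (ha : ∀ i, 0 ≤ a i) :
    sInf {v : ℝ | ∃ υ : Fin ν → ℝ, (∀ i, 0 < υ i) ∧
        v = (1 / 4 : ℝ) * (∑ i, (a i) ^ 2 / υ i) +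
          (if p = 2 then ⨆ i, |υ i|
           else (∑ i, |υ i| ^ (p / (2 - p))) ^ ((2 - p) / p))}
      = (∑ i, (a i) ^ p) ^ (1 / p) := by
  have : Nonempty (Fin ν) := ⟨⟨0, hν⟩⟩
  have hp0 : 0 < p := by linarith
  apply le_antisymm
  · have hcont : Continuous fun ε : ℝ => (∑ i, (a i + ε) ^ p) ^ (1 / p) :=
      (continuous_finsetSum _ fun i _ =>
        (continuous_const.add continuous_id).rpow_const fun _ => Or.inr hp0.le).rpow_const
          fun _ => Or.inr (by positivity)
    have hlim := (hcont.tendsto 0).mono_left (nhdsWithin_le_nhds (s := Set.Ioi 0))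
    simp only [add_zero] at hlim
    refine ge_of_tendsto hlim ?_
    filter_upwards [self_mem_nhdsWithin] with ε hε
    have hε0 : 0 < ε := hε
    obtain ⟨υ, hυ, heq⟩ := exists_quarter_sum_add_norm_eq hp1
      (b := fun i => a i + ε) fun i => add_pos_of_nonneg_of_pos (ha i) hε0
    rw [← heq]
    refine (csInf_le ⟨(∑ i, a i ^ p) ^ (1 / p), ?_⟩ (Exists.intro υ ⟨hυ, rfl⟩)).trans ?_
    · rintro _ ⟨w, hw, rfl⟩
      exact norm_le_quarter_sum_add_norm hp1 hp2 ha hw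
    · gcongr with i
      · exact (hυ i).le
      · exact ha i
      · linarith
  · refine le_csInf ⟨_, fun _ => 1, fun _ => one_pos, rfl⟩ ?_
    rintro _ ⟨υ, hυ, rfl⟩
    exact norm_le_quarter_sum_add_norm hp1 hp2 ha hυ
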